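/- Let p be a prime and let G be a non-abelian finite p-group of order p^n with commutator subgroup G' of order p^k where k ≥ 2, d = d(G), and suppose |M(G)| = p^{(1/2)(d-1)(n+k-2)+1}. If K is a subgroup of order p contained in Z(G) ∩ G', then |M(G/K)| = p^{(1/2)(d-1)(n+k-4)+1}; that is, |M(G/K)| attains the bound for the group G/K (which has order p^{n-1}, commutator subgroup of order p^{k-1}, and minimal number of generators d). -/

import Mathlib

/-- The minimal number of elements required to generate a group `G`. -/
noncomputable def minGens (G : Type*) [Group G] : ℕ :=
  sInf {n | ∃ S : Finset G, S.card = n ∧ Subgroup.closure (S : Set G) = ⊤}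

/-- The cardinality of the Hopf quotient `(R ∩ [F,F]) / [R,F]` associated to a
presentation `π : F → G` with kernel `R = ker π`. -/
noncomputable def hopfCard {F G : Type*} [Group F] [Group G] (π : F →* G) : ℕ :=
  Nat.card ((π.ker ⊓ commutator F : Subgroup F) ⧸
    (⁅π.ker, (⊤ : Subgroup F)⁆.subgroupOf (π.ker ⊓ commutator F)))

/-- The order of the Schur multiplier `M(G)`, computed by Hopf's formula from the
canonical free presentation `FreeGroup G → G`. -/
noncomputable def schurCard (G : Type*) [Group G] : ℕ :=
  hopfCard (FreeGroup.lift (id : G → G))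

/-- A subgroup contained in the center is normal. -/
theorem normal_of_le_center' {G : Type*} [Group G] {K : Subgroup G}
    (h : K ≤ Subgroup.center G) : K.Normal :=
  ⟨fun k hk g => by
    have hc := Subgroup.mem_center_iff.mp (h hk) g
    have : g * k * g⁻¹ = k := by rw [hc]; group
    rwa [this]⟩

open scoped commutatorElement IsMulCommutative

theorem aux_card_closure_le {ι C : Type*} [Fintype ι] [CommGroup C] (x : ι → C) (n : ι → ℕ)
    (hn : ∀ i, 0 < n i) (hx : ∀ i, x i ^ n i = 1) :
    Finite (Subgroup.closure (Set.range x)) ∧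
    Nat.card (Subgroup.closure (Set.range x)) ≤ ∏ i, n i := by
  have hsub : ((Subgroup.closure (Set.range x) : Subgroup C) : Set C) ⊆
      Set.range (fun f : (∀ i, Fin (n i)) => ∏ i, x i ^ ((f i : ℕ))) := by
    intro y hy
    obtain ⟨a, rfl⟩ := Subgroup.exists_of_mem_closure_range x y hy
    refine ⟨fun i => ⟨(a i % (n i : ℤ)).toNat, ?_⟩, ?_⟩
    · have h1 := Int.emod_lt_of_pos (a i) (b := (n i : ℤ)) (by exact_mod_cast hn i)
      have := hn i
      omega
    · refine Finset.prod_congr rfl fun i _ => ?_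
      have h0 := Int.emod_nonneg (a i) (b := (n i : ℤ)) (by have := hn i; omega)
      have : x i ^ (a i) = x i ^ (a i % (n i : ℤ)) := by
        conv_lhs => rw [← Int.emod_add_mul_ediv (a i) (n i : ℤ)]
        rw [zpow_add, zpow_mul, zpow_natCast, hx i, one_zpow, mul_one]
      rw [this, ← zpow_natCast]
      simp only [Int.toNat_of_nonneg h0]
  have h1 := Nat.card_mono (Set.finite_range _) hsub
  have h2 : Nat.card (Set.range (fun f : (∀ i, Fin (n i)) => ∏ i, x i ^ ((f i : ℕ)))) ≤
      Nat.card (∀ i, Fin (n i)) := Finite.card_range_le _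
  refine ⟨(Set.Finite.subset (Set.finite_range _) hsub).to_subtype, (h1.trans h2).trans ?_⟩
  simp [Nat.card_pi]

theorem aux_gen_top {ι H G : Type*} [Group H] [Group G] (ρ : H →* G) (y : ι → H)
    (hy : Subgroup.closure (Set.range (fun i => ρ (y i))) = ⊤) (L : Subgroup H)
    (hker : ρ.ker ≤ L) (hL : ∀ i, y i ∈ L) : L = ⊤ := by
  rw [← Subgroup.comap_map_eq_self hker]
  have : L.map ρ = ⊤ := by
    rw [eq_top_iff, ← hy, Subgroup.closure_le]
    rintro _ ⟨i, rfl⟩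
    exact ⟨y i, hL i, rfl⟩
  rw [this, Subgroup.comap_top]

/-- commutation with `s` as a homomorphism when all commutators `⁅s, h⁆` are central -/
def auxBr {H : Type*} [Group H] (s : H) (hs : ∀ h, ⁅s, h⁆ ∈ Subgroup.center H) :
    H →* Subgroup.center H where
  toFun h := ⟨⁅s, h⁆, hs h⟩
  map_one' := by ext; simp
  map_mul' a b := by
    ext
    simp only [Subgroup.coe_mul]
    rw [commutatorElement_mul_right_eq_mul_conj, mul_assoc _ a,
      Subgroup.mem_center_iff.mp (hs b) a]
    group

theorem auxBr_coe {H : Type*} [Group H] (s : H) (hs : ∀ h, ⁅s, h⁆ ∈ Subgroup.center H) (h : H) :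
    ((auxBr s hs h : Subgroup.center H) : H) = ⁅s, h⁆ := rfl

theorem aux_comm_zpow {H : Type*} [Group H] (s h : H) (hs : ⁅s, h⁆ ∈ Subgroup.center H) (i : ℤ)
    (r : H) (hr : r ∈ Subgroup.center H) : ⁅s ^ i * r, h⁆ = ⁅s, h⁆ ^ i := by
  have h1 : h * s * h⁻¹ = ⁅s, h⁆⁻¹ * s := by rw [commutatorElement_def]; group
  have hc : Commute (⁅s, h⁆⁻¹) s :=
    (Subgroup.mem_center_iff.mp (Subgroup.inv_mem _ hs) s).symm
  have h2 : h * s ^ i * h⁻¹ = ⁅s, h⁆⁻¹ ^ i * s ^ i := by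
    rw [← conj_zpow, h1, hc.mul_zpow]
  have h3 := Subgroup.mem_center_iff.mp hr h
  calc ⁅s ^ i * r, h⁆ = s ^ i * (r * h) * r⁻¹ * s ^ (-i) * h⁻¹ := by
        rw [commutatorElement_def]; group
    _ = s ^ i * (h * s ^ i * h⁻¹)⁻¹ := by rw [← h3]; group
    _ = ⁅s, h⁆ ^ i := by rw [h2, mul_inv_rev, inv_zpow, inv_inv, mul_inv_cancel_left]

theorem aux_exists_rep {H G : Type*} [Group H] [Group G] (ρ : H →* G) (s : H) (K : Subgroup G)
    (hK : K = Subgroup.zpowers (ρ s)) (g : H) (hg : ρ g ∈ K) :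
    ∃ i : ℤ, ∃ r ∈ ρ.ker, g = s ^ i * r := by
  rw [hK] at hg
  obtain ⟨i, hi⟩ := hg
  refine ⟨i, (s ^ i)⁻¹ * g, ?_, by group⟩
  rw [MonoidHom.mem_ker]
  simp only [map_mul, map_inv, map_zpow]
  simp only [] at hi
  rw [hi]; group

/-- the core: `⁅K.comap ρ, ⊤⁆` is covered by the image of the commutation map. -/
theorem aux_card_comm_le {H G : Type*} [Group H] [Group G] {p : ℕ} (hp : p.Prime)
    (ρ : H →* G) (hker : ρ.ker ≤ Subgroup.center H)
    (s : H) (hs : ∀ h, ⁅s, h⁆ ∈ Subgroup.center H) (hsp : ρ s ^ p = 1) (K : Subgroup G)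
    (hK : K = Subgroup.zpowers (ρ s)) {ι : Type*} [Fintype ι] (y : ι → H)
    (hy : ∀ h, auxBr s hs h ∈ Subgroup.closure (Set.range (fun i => auxBr s hs (y i)))) :
    Nat.card (⁅K.comap ρ, (⊤ : Subgroup H)⁆ : Subgroup H) ≤ p ^ Fintype.card ι := by
  set L := Subgroup.closure (Set.range (fun i => auxBr s hs (y i))) with hL
  have hle : ⁅K.comap ρ, (⊤ : Subgroup H)⁆ ≤ L.map (Subgroup.center H).subtype := by
    rw [Subgroup.commutator_le]
    intro g hg h _
    obtain ⟨i, r, hr, rfl⟩ := aux_exists_rep ρ s K hK g hg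
    rw [aux_comm_zpow s h (hs h) i r (hker hr)]
    have h5 : ⁅s, h⁆ ∈ L.map (Subgroup.center H).subtype := ⟨auxBr s hs h, hy h, rfl⟩
    exact Subgroup.zpow_mem _ h5 i
  have hpow : ∀ h, auxBr s hs h ^ p = 1 := by
    intro h
    ext
    have h1 : s ^ p ∈ Subgroup.center H := hker (by rw [MonoidHom.mem_ker, map_pow, hsp])
    have h2 := aux_comm_zpow s h (hs h) (p : ℤ) 1 (Subgroup.one_mem _)
    rw [mul_one, zpow_natCast, zpow_natCast] at h2
    rw [SubmonoidClass.coe_pow, auxBr_coe, ← h2]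
    exact commutatorElement_eq_one_iff_mul_comm.mpr (Subgroup.mem_center_iff.mp h1 h).symm
  obtain ⟨hfin, hc⟩ := aux_card_closure_le (fun i => auxBr s hs (y i)) (fun _ => p) (fun _ => hp.pos)
    (fun i => hpow _)
  rw [Finset.prod_const, Finset.card_univ] at hc
  refine le_trans ?_ hc
  have : Finite (L.map (Subgroup.center H).subtype) := by
    exact Finite.Set.finite_image _ _
  refine (Subgroup.card_le_of_le hle).trans ?_
  exact Nat.le_of_dvd Nat.card_pos (Subgroup.card_map_dvd _ _)

theorem aux_stepB {H G : Type*} [Group H] [Group G] {p d : ℕ} (hp : p.Prime)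
    (ρ : H →* G) (hρ : Function.Surjective ρ) (hker : ρ.ker ≤ Subgroup.center H)
    (K : Subgroup G) (hK : K ≤ Subgroup.center G) (hKp : Nat.card K = p)
    (x : Fin d → G) (hx : Subgroup.closure (Set.range x) = ⊤) :
    Nat.card (⁅K.comap ρ, (⊤ : Subgroup H)⁆ : Subgroup H) ≤ p ^ d := by
  have : Fact p.Prime := ⟨hp⟩
  obtain ⟨c, hc⟩ := (isCyclic_of_prime_card hKp).exists_generator
  obtain ⟨s, hs⟩ := hρ (c : G)
  have hKc : K = Subgroup.zpowers (ρ s) := by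
    rw [hs]
    apply le_antisymm
    · intro g hg
      obtain ⟨i, hi⟩ := hc ⟨g, hg⟩
      exact ⟨i, by simpa using congrArg Subtype.val hi⟩
    · simp
  have hsz : ∀ h, ⁅s, h⁆ ∈ Subgroup.center H := by
    intro h
    apply hker
    rw [MonoidHom.mem_ker, map_commutatorElement, commutatorElement_eq_one_iff_mul_comm, hs]
    exact (Subgroup.mem_center_iff.mp (hK c.2) _).symm
  have hsp : ρ s ^ p = 1 := by
    rw [hs, ← hKp]
    exact_mod_cast congrArg Subtype.val (pow_card_eq_one' (x := c))
  choose y hy using fun i => hρ (x i)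
  have hfun : (fun i => ρ (y i)) = x := funext hy
  have := aux_card_comm_le hp ρ hker s hsz hsp K hKc y ?_
  · simpa using this
  intro h
  have htop := aux_gen_top ρ y (by rw [hfun, hx])
    ((Subgroup.closure (Set.range (fun i => auxBr s hsz (y i)))).comap (auxBr s hsz)) ?_ ?_
  · have : h ∈ (⊤ : Subgroup H) := trivial
    rw [← htop] at this
    exact this
  · intro r hr
    rw [Subgroup.mem_comap]
    have : auxBr s hsz r = 1 := by
      ext
      rw [auxBr_coe]
      exact commutatorElement_eq_one_iff_mul_comm.mpr (Subgroup.mem_center_iff.mp (hker hr) s)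
    rw [this]; exact Subgroup.one_mem _
  · intro i
    exact Subgroup.subset_closure ⟨i, rfl⟩

theorem aux_stepB' {H G : Type*} [Group H] [Group G] {p : ℕ} (hp : p.Prime)
    (ρ : H →* G) (hρ : Function.Surjective ρ) (hker : ρ.ker ≤ Subgroup.center H)
    (K : Subgroup G) (hK : K ≤ Subgroup.center G) (hKp : Nat.card K = p)
    (hKG : K = commutator G) :
    Nat.card (⁅K.comap ρ, (⊤ : Subgroup H)⁆ : Subgroup H) ≤ p ^ 2 := by
  have : Fact p.Prime := ⟨hp⟩
  have hcomm : ∀ a b : G, ⁅a, b⁆ ∈ K := fun a b => by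
    rw [hKG]
    exact Subgroup.commutator_mem_commutator (Subgroup.mem_top _) (Subgroup.mem_top _)
  obtain ⟨a, b, hab⟩ : ∃ a b : G, ⁅a, b⁆ ≠ 1 := by
    by_contra! hcon
    have : commutator G ≤ ⊥ := by
      rw [commutator_def, Subgroup.commutator_le]
      intro a _ b _
      rw [hcon a b]; exact Subgroup.one_mem _
    rw [← hKG, le_bot_iff] at this
    rw [this, Subgroup.card_bot] at hKp
    exact hp.one_lt.ne hKp
  obtain ⟨x, rfl⟩ := hρ a
  obtain ⟨y, rfl⟩ := hρ b
  obtain ⟨s, hs⟩ : ∃ s, s = ⁅x, y⁆ := ⟨_, rfl⟩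
  have hρs : ρ s = ⁅ρ x, ρ y⁆ := by rw [hs, map_commutatorElement]
  have hsK : ρ s ∈ K := hρs ▸ hcomm _ _
  have hKfin : Finite K := Nat.finite_of_card_ne_zero (by rw [hKp]; exact hp.ne_zero)
  have hsp : ρ s ^ p = 1 := by
    rw [← hKp]
    exact congrArg Subtype.val (pow_card_eq_one' (x := (⟨ρ s, hsK⟩ : K)))
  have hKc : K = Subgroup.zpowers (ρ s) := by
    symm
    apply Subgroup.eq_of_le_of_card_ge
    · simpa using hsK
    · rw [hKp, Nat.card_zpowers, orderOf_eq_prime hsp (by rw [hρs]; exact hab)]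
  have hsz : ∀ h, ⁅s, h⁆ ∈ Subgroup.center H := by
    intro h
    apply hker
    rw [MonoidHom.mem_ker, map_commutatorElement, commutatorElement_eq_one_iff_mul_comm]
    exact (Subgroup.mem_center_iff.mp (hK hsK) _).symm
  have := aux_card_comm_le hp ρ hker s hsz hsp K hKc ![x, y] ?_
  · simpa using this
  intro z
  set L := Subgroup.closure (Set.range (fun i => auxBr s hsz (![x, y] i))) with hL
  have hxL : auxBr s hsz x ∈ L := Subgroup.subset_closure ⟨0, rfl⟩
  have hyL : auxBr s hsz y ∈ L := Subgroup.subset_closure ⟨1, rfl⟩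
  have hconj : ∀ u v, auxBr s hsz (u * v * u⁻¹) = auxBr s hsz v := by
    intro u v
    rw [map_mul, map_mul, mul_comm, ← mul_assoc, ← map_mul, inv_mul_cancel, map_one, one_mul]
  have key : ∀ u v w : H, ∃ i : ℤ, ⁅⁅u, v⁆, w⁆ = ((auxBr s hsz w ^ i : Subgroup.center H) : H) := by
    intro u v w
    obtain ⟨i, r, hr, h⟩ := aux_exists_rep ρ s K hKc ⁅u, v⁆
      (by rw [map_commutatorElement]; exact hcomm _ _)
    refine ⟨i, ?_⟩
    rw [h, aux_comm_zpow s w (hsz w) i r (hker hr)]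
    simp [auxBr_coe]
  have HW := commutatorElement_commutatorElement_conj_mul x y z
  obtain ⟨i, hi⟩ := key y z (z * x * z⁻¹)
  obtain ⟨j, hj⟩ := key z x (x * y * x⁻¹)
  rw [hi, hj, ← hs, ← auxBr_coe s hsz, hconj, hconj, hconj] at HW
  have HW' : auxBr s hsz z * auxBr s hsz x ^ i * auxBr s hsz y ^ j = 1 := by
    ext; exact_mod_cast HW
  have : auxBr s hsz z = (auxBr s hsz y ^ j)⁻¹ * (auxBr s hsz x ^ i)⁻¹ := by
    rw [mul_assoc] at HW'
    rw [eq_inv_of_mul_eq_one_left HW', mul_inv_rev]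
  rw [this]
  exact L.mul_mem (L.inv_mem (L.zpow_mem hyL _)) (L.inv_mem (L.zpow_mem hxL _))

theorem aux_prod_pairs {ι : Type*} [Fintype ι] [LinearOrder ι] (n : ι → ℕ) :
    ∏ q : {q : ι × ι // q.1 < q.2}, (n q.1.1 * n q.1.2) = (∏ i, n i) ^ (Fintype.card ι - 1) := by
  classical
  have h1 : ∏ q : {q : ι × ι // q.1 < q.2}, (n q.1.1 * n q.1.2) =
      ∏ q ∈ (Finset.univ : Finset (ι × ι)).filter (fun q => q.1 < q.2), (n q.1 * n q.2) := by
    rw [Finset.prod_subtype (p := fun q : ι × ι => q.1 < q.2) _ (by simp) (fun q => n q.1 * n q.2)]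
  have h2 : ∏ q ∈ (Finset.univ : Finset (ι × ι)).filter (fun q => q.1 < q.2), n q.2 =
      ∏ q ∈ (Finset.univ : Finset (ι × ι)).filter (fun q => q.2 < q.1), n q.1 := by
    refine Finset.prod_nbij' Prod.swap Prod.swap ?_ ?_ ?_ ?_ ?_ <;> simp
  rw [h1, Finset.prod_mul_distrib, h2, ← Finset.prod_union]
  · have h3 : (Finset.univ : Finset (ι × ι)).filter (fun q => q.1 < q.2) ∪
        (Finset.univ : Finset (ι × ι)).filter (fun q => q.2 < q.1) =
        (Finset.univ : Finset (ι × ι)).filter (fun q => q.1 ≠ q.2) := by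
      ext q; simp [lt_or_lt_iff_ne]
    rw [h3, Finset.prod_filter, Fintype.prod_prod_type, ← Finset.prod_pow]
    refine Finset.prod_congr rfl fun i _ => ?_
    rw [← Finset.prod_filter]
    simp only [Finset.prod_const]
    congr 1
    rw [Finset.filter_ne, Finset.card_erase_of_mem (Finset.mem_univ _), Finset.card_univ]
  · rw [Finset.disjoint_filter]
    intro q _ h
    exact h.le.not_gt

theorem aux_closure_single {ι : Type*} [Fintype ι] [DecidableEq ι] (n : ι → ℕ) :
    Subgroup.closure (Set.range (fun i => (Pi.mulSingle i (Multiplicative.ofAdd (1 : ZMod (n i))) :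
      (i : ι) → Multiplicative (ZMod (n i))))) = ⊤ := by
  rw [eq_top_iff]
  intro w _
  rw [← Finset.univ_prod_mulSingle w]
  refine Subgroup.prod_mem _ fun i _ => ?_
  obtain ⟨a, ha⟩ := ZMod.intCast_surjective (Multiplicative.toAdd (w i))
  have : w i = Multiplicative.ofAdd (1 : ZMod (n i)) ^ a := by
    rw [← ofAdd_zsmul, zsmul_one, ha, ofAdd_toAdd]
  rw [this, Pi.mulSingle_zpow]
  exact Subgroup.zpow_mem _ (Subgroup.subset_closure (Set.mem_range_self i)) _

theorem aux_rank_le {A : Type*} [CommGroup A] {p d m : ℕ} (hp : p.Prime)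
    (hA : Nat.card A = p ^ m)
    (x : Fin d → A) (hx : Subgroup.closure (Set.range x) = ⊤)
    {ι : Type*} [Fintype ι] (n : ι → ℕ) (hn : ∀ i, 1 < n i)
    (e : A ≃* ((i : ι) → Multiplicative (ZMod (n i)))) : Fintype.card ι ≤ d := by
  have hprod : ∏ i, n i = p ^ m := by
    rw [← hA, Nat.card_congr e.toEquiv, Nat.card_pi]
    refine Finset.prod_congr rfl fun i _ => ?_
    exact (Nat.card_zmod (n i)).symm
  have hdvd : ∀ i, p ∣ n i := by
    intro i
    have h1 : n i ∣ p ^ m := hprod ▸ Finset.dvd_prod_of_mem n (Finset.mem_univ i)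
    obtain ⟨j, _, hj⟩ := (Nat.dvd_prime_pow hp).mp h1
    rcases j with _ | j
    · have := hn i; simp [hj] at this
    · rw [hj]; exact dvd_pow_self p (by omega)
  let f : A →* ((i : ι) → Multiplicative (ZMod p)) :=
    (MonoidHom.mk' (fun w i => Multiplicative.ofAdd
      (ZMod.castHom (hdvd i) (ZMod p) (Multiplicative.toAdd (w i)))) (by
        intro a b; funext i; rw [Pi.mul_apply, Pi.mul_apply, toAdd_mul, map_add, ofAdd_add]) : ((i : ι) → Multiplicative (ZMod (n i))) →* _).comp e.toMonoidHom
  have hf : Function.Surjective f := by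
    intro w
    choose v hv using fun i => ZMod.castHom_surjective (hdvd i) (Multiplicative.toAdd (w i))
    refine ⟨e.symm (fun i => Multiplicative.ofAdd (v i)), ?_⟩
    funext i
    simp only [f, MonoidHom.comp_apply, MulEquiv.coe_toMonoidHom, MulEquiv.apply_symm_apply,
      MonoidHom.mk'_apply, toAdd_ofAdd, hv, ofAdd_toAdd]
  have hcl : Subgroup.closure (Set.range (fun i => f (x i))) = ⊤ := by
    have : Set.range (fun i => f (x i)) = f '' Set.range x := by
      rw [← Set.range_comp]; rfl
    rw [this, ← MonoidHom.map_closure, hx, Subgroup.map_top_of_surjective _ hf]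
  have hb := (aux_card_closure_le (fun i => f (x i)) (fun _ => p) (fun _ => hp.pos) (by
    intro i
    funext j
    rw [Pi.pow_apply]
    apply Multiplicative.toAdd.injective
    rw [toAdd_pow]
    simp)).2
  rw [hcl, Subgroup.card_top, Nat.card_pi] at hb
  simp only [Finset.prod_const, Finset.card_univ, Fintype.card_fin] at hb
  have h4 : Nat.card (Multiplicative (ZMod p)) = p := Nat.card_zmod p
  rw [h4] at hb
  exact (Nat.pow_le_pow_iff_right hp.one_lt).mp hb

theorem aux_stepC {H A : Type*} [Group H] [Group A] [Finite A] {p d m : ℕ} (hp : p.Prime)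
    (hcomm : ∀ a b : A, a * b = b * a) (hA : Nat.card A = p ^ m)
    (ρ : H →* A) (hρ : Function.Surjective ρ) (hker : ρ.ker ≤ Subgroup.center H)
    (x : Fin d → A) (hx : Subgroup.closure (Set.range x) = ⊤) :
    Nat.card (commutator H) ^ 2 ≤ p ^ ((d - 1) * m) := by
  classical
  let _ : CommGroup A := { (inferInstance : Group A) with mul_comm := hcomm }
  obtain ⟨ι, _, n, hn, ⟨e⟩⟩ := CommGroup.equiv_prod_multiplicative_zmod_of_finite A
  let _ : LinearOrder ι := LinearOrder.lift' (Fintype.equivFin ι) (Fintype.equivFin ι).injective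
  have hrank := aux_rank_le hp hA x hx n hn e
  have hprod : ∏ i, n i = p ^ m := by
    rw [← hA, Nat.card_congr e.toEquiv, Nat.card_pi]
    refine Finset.prod_congr rfl fun i _ => ?_
    exact (Nat.card_zmod (n i)).symm
  have hz : ∀ u v : H, ⁅u, v⁆ ∈ Subgroup.center H := by
    intro u v
    apply hker
    rw [MonoidHom.mem_ker, map_commutatorElement, commutatorElement_eq_one_iff_mul_comm]
    exact hcomm _ _
  choose y hy using fun i => hρ (e.symm (Pi.mulSingle i (Multiplicative.ofAdd (1 : ZMod (n i)))))
  have hgen : Subgroup.closure (Set.range (fun i => ρ (y i))) = ⊤ := by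
    have : Set.range (fun i => ρ (y i)) = e.symm.toMonoidHom '' Set.range (fun i => (Pi.mulSingle i (Multiplicative.ofAdd (1 : ZMod (n i))) :
      (i : ι) → Multiplicative (ZMod (n i)))) := by
      rw [← Set.range_comp]; congr 1; funext i; exact hy i
    rw [this, ← MonoidHom.map_closure, aux_closure_single,
      Subgroup.map_top_of_surjective _ e.symm.surjective]
  have hyn : ∀ i, y i ^ n i ∈ Subgroup.center H := by
    intro i
    apply hker
    rw [MonoidHom.mem_ker, map_pow, hy, ← map_pow, ← Pi.mulSingle_pow, ← ofAdd_nsmul]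
    simp
  have hpowl : ∀ (i : ι) (v : H), ⁅y i, v⁆ ^ n i = 1 := by
    intro i v
    have h2 := aux_comm_zpow (y i) v (hz _ _) (n i : ℤ) 1 (Subgroup.one_mem _)
    rw [mul_one, zpow_natCast, zpow_natCast] at h2
    rw [← h2]
    exact commutatorElement_eq_one_iff_mul_comm.mpr (Subgroup.mem_center_iff.mp (hyn i) v).symm
  have hpowr : ∀ (i : ι) (v : H), ⁅v, y i⁆ ^ n i = 1 := by
    intro i v
    rw [← commutatorElement_inv, inv_pow, hpowl, inv_one]
  let g : {q : ι × ι // q.1 < q.2} → Subgroup.center H := fun q => ⟨⁅y q.1.1, y q.1.2⁆, hz _ _⟩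
  obtain ⟨hfin, hcard⟩ := aux_card_closure_le g (fun q => Nat.gcd (n q.1.1) (n q.1.2))
    (fun q => Nat.gcd_pos_of_pos_left _ (by have := hn q.1.1; omega)) (by
      intro q
      ext
      rw [SubmonoidClass.coe_pow]
      exact pow_gcd_eq_one.mpr ⟨hpowl _ _, hpowr _ _⟩)
  set L := Subgroup.closure (Set.range g) with hL
  let br : ∀ u : H, H →* Subgroup.center H := fun u => auxBr u (hz u)
  have hinv : ∀ u v, br u v ∈ L → br v u ∈ L := by
    intro u v h
    have : br v u = (br u v)⁻¹ := by
      ext; simp [br, auxBr_coe]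
    rw [this]; exact L.inv_mem h
  have hcen : ∀ u r, r ∈ Subgroup.center H → br u r = 1 := by
    intro u r hr
    ext
    exact commutatorElement_eq_one_iff_mul_comm.mpr (Subgroup.mem_center_iff.mp hr u)
  have hstep1 : ∀ i j, br (y i) (y j) ∈ L := by
    intro i j
    rcases lt_trichotomy i j with h | h | h
    · exact Subgroup.subset_closure ⟨⟨(i, j), h⟩, rfl⟩
    · subst h
      have : br (y i) (y i) = 1 := by ext; simp [br, auxBr_coe]
      rw [this]; exact L.one_mem
    · exact hinv _ _ (Subgroup.subset_closure ⟨⟨(j, i), h⟩, rfl⟩)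
  have hext : ∀ u, (∀ i, br u (y i) ∈ L) → ∀ v, br u v ∈ L := by
    intro u hu v
    have htop := aux_gen_top ρ y hgen (L.comap (br u)) (by
      intro r hr
      rw [Subgroup.mem_comap, hcen u r (hker hr)]; exact L.one_mem) hu
    have : v ∈ (⊤ : Subgroup H) := trivial
    rw [← htop] at this
    exact this
  have hall : ∀ u v, br u v ∈ L := fun u v =>
    hext u (fun i => hinv _ _ (hext (y i) (hstep1 i) u)) v
  have hle : commutator H ≤ L.map (Subgroup.center H).subtype := by
    rw [commutator_def, Subgroup.commutator_le]
    intro u _ v _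
    exact ⟨br u v, hall u v, rfl⟩
  have : Finite (L.map (Subgroup.center H).subtype) := Finite.Set.finite_image _ _
  have hc1 : Nat.card (commutator H) ≤ ∏ q : {q : ι × ι // q.1 < q.2}, Nat.gcd (n q.1.1) (n q.1.2) :=
    ((Subgroup.card_le_of_le hle).trans
      (Nat.le_of_dvd Nat.card_pos (Subgroup.card_map_dvd _ _))).trans hcard
  calc Nat.card (commutator H) ^ 2
      ≤ (∏ q : {q : ι × ι // q.1 < q.2}, Nat.gcd (n q.1.1) (n q.1.2)) ^ 2 :=
        Nat.pow_le_pow_left hc1 2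
    _ ≤ ∏ q : {q : ι × ι // q.1 < q.2}, (n q.1.1 * n q.1.2) := by
        rw [← Finset.prod_pow]
        refine Finset.prod_le_prod' fun q _ => ?_
        rw [sq]
        exact Nat.mul_le_mul (Nat.gcd_le_left _ (by have := hn q.1.1; omega))
          (Nat.gcd_le_right _ (by have := hn q.1.2; omega))
    _ = p ^ (m * (Fintype.card ι - 1)) := by rw [aux_prod_pairs, hprod, pow_mul]
    _ ≤ p ^ ((d - 1) * m) := by
        apply Nat.pow_le_pow_right hp.pos
        rw [mul_comm]
        exact Nat.mul_le_mul_right _ (by omega)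

theorem hopfCard_eq {F G : Type*} [Group F] [Group G] (π : F →* G) :
    hopfCard π = (⁅π.ker, (⊤ : Subgroup F)⁆).relIndex (π.ker ⊓ commutator F) := rfl

theorem aux_ker_central {F G : Type*} [Group F] [Group G] (π : F →* G) (r : F) (hr : r ∈ π.ker) :
    (QuotientGroup.mk' ⁅π.ker, (⊤ : Subgroup F)⁆) r ∈
      Subgroup.center (F ⧸ ⁅π.ker, (⊤ : Subgroup F)⁆) := by
  rw [Subgroup.mem_center_iff]
  intro g
  obtain ⟨f, rfl⟩ := QuotientGroup.mk'_surjective _ g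
  symm
  rw [← commutatorElement_eq_one_iff_mul_comm, ← map_commutatorElement, ← MonoidHom.mem_ker,
    QuotientGroup.ker_mk']
  exact Subgroup.commutator_mem_commutator hr (Subgroup.mem_top _)

/-- An endomorphism over `G` acts trivially on `[F,F]/[R,F]`. -/
theorem aux_endo {F G : Type*} [Group F] [Group G] (π : F →* G) (γ : F →* F)
    (hγ : ∀ f, π (γ f) = π f) (w : F) (hw : w ∈ commutator F) :
    w⁻¹ * γ w ∈ ⁅π.ker, (⊤ : Subgroup F)⁆ := by
  set N := ⁅π.ker, (⊤ : Subgroup F)⁆ with hN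
  set q := QuotientGroup.mk' N with hq
  have hc : ∀ f, q (f⁻¹ * γ f) ∈ Subgroup.center (F ⧸ N) := fun f =>
    aux_ker_central π _ (by rw [MonoidHom.mem_ker, map_mul, hγ, map_inv, inv_mul_cancel])
  let χ : F →* Subgroup.center (F ⧸ N) := MonoidHom.mk' (fun f => ⟨q (f⁻¹ * γ f), hc f⟩) (by
    intro a b
    ext
    simp only [Subgroup.coe_mul]
    have h1 := Subgroup.mem_center_iff.mp (hc a) (q b⁻¹)
    calc q ((a * b)⁻¹ * γ (a * b)) = (q b⁻¹ * q (a⁻¹ * γ a)) * q (γ b) := by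
          rw [← map_mul, ← map_mul, map_mul γ]; congr 1; group
      _ = _ := by rw [h1, mul_assoc, ← map_mul])
  have h2 := Abelianization.commutator_subset_ker χ hw
  have h3 : q (w⁻¹ * γ w) = 1 := congrArg Subtype.val (MonoidHom.mem_ker.mp h2)
  rwa [← MonoidHom.mem_ker, hq, QuotientGroup.ker_mk'] at h3

theorem aux_map_mem {F F' G : Type*} [Group F] [Group F'] [Group G] (π : F →* G) (π' : F' →* G)
    (α : F →* F') (hα : ∀ f, π' (α f) = π f) :
    (π.ker ⊓ commutator F).map α ≤ π'.ker ⊓ commutator F' ∧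
    (⁅π.ker, (⊤ : Subgroup F)⁆).map α ≤ ⁅π'.ker, (⊤ : Subgroup F')⁆ := by
  have h1 : π.ker.map α ≤ π'.ker := by
    rintro _ ⟨r, hr, rfl⟩
    rw [MonoidHom.mem_ker, hα]; exact hr
  constructor
  · refine le_inf ((Subgroup.map_mono inf_le_left).trans h1) ((Subgroup.map_mono inf_le_right).trans ?_)
    rw [commutator_def, Subgroup.map_commutator]
    exact Subgroup.commutator_mono le_top le_top
  · rw [Subgroup.map_commutator]
    exact Subgroup.commutator_mono h1 le_top

/-- functoriality -/
def auxHopfMap {F F' G : Type*} [Group F] [Group F'] [Group G] (π : F →* G) (π' : F' →* G)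
    (α : F →* F') (hα : ∀ f, π' (α f) = π f) :
    ((π.ker ⊓ commutator F : Subgroup F) ⧸
      (⁅π.ker, (⊤ : Subgroup F)⁆.subgroupOf (π.ker ⊓ commutator F))) →
    ((π'.ker ⊓ commutator F' : Subgroup F') ⧸
      (⁅π'.ker, (⊤ : Subgroup F')⁆.subgroupOf (π'.ker ⊓ commutator F'))) :=
  Quotient.map' (fun w => ⟨α w.1, (aux_map_mem π π' α hα).1 ⟨w.1, w.2, rfl⟩⟩) (by
    intro a b h
    rw [QuotientGroup.leftRel_apply] at h ⊢
    rw [Subgroup.mem_subgroupOf] at h ⊢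
    refine (aux_map_mem π π' α hα).2 ⟨_, h, ?_⟩
    simp)

theorem aux_hopf_inv {F F' G : Type*} [Group F] [Group F'] [Group G] (π : F →* G) (π' : F' →* G)
    (α : F →* F') (hα : ∀ f, π' (α f) = π f) (β : F' →* F) (hβ : ∀ f, π (β f) = π' f) :
    Function.LeftInverse (auxHopfMap π' π β hβ) (auxHopfMap π π' α hα) := by
  intro a
  induction a using Quotient.inductionOn' with
  | h w =>
    symm
    refine Quotient.sound' ?_
    rw [QuotientGroup.leftRel_apply, Subgroup.mem_subgroupOf]
    exact aux_endo π (β.comp α) (fun f => by simp [hα, hβ]) w.1 w.2.2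

theorem aux_hopf_indep {X Y G : Type*} [Group G] (π : FreeGroup X →* G) (π' : FreeGroup Y →* G)
    (h : Function.Surjective π) (h' : Function.Surjective π') : hopfCard π = hopfCard π' := by
  choose a ha using fun x => h' (π (FreeGroup.of x))
  choose b hb using fun x => h (π' (FreeGroup.of x))
  have hα : ∀ f, π' (FreeGroup.lift a f) = π f := by
    intro f
    have : π'.comp (FreeGroup.lift a) = π := by ext x; simp [ha]
    exact DFunLike.congr_fun this f
  have hβ : ∀ f, π (FreeGroup.lift b f) = π' f := by
    intro f
    have : π.comp (FreeGroup.lift b) = π' := by ext x; simp [hb]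
    exact DFunLike.congr_fun this f
  exact Nat.card_congr ⟨auxHopfMap π π' _ hα, auxHopfMap π' π _ hβ,
    aux_hopf_inv π π' _ hα _ hβ, aux_hopf_inv π' π _ hβ _ hα⟩

theorem aux_lift_surj (G : Type*) [Group G] :
    Function.Surjective (FreeGroup.lift (id : G → G)) := fun g => ⟨FreeGroup.of g, by simp⟩

theorem aux_ker_mk_comp {F G : Type*} [Group F] [Group G] (π : F →* G) (K : Subgroup G) [K.Normal] :
    ((QuotientGroup.mk' K).comp π).ker = K.comap π := by
  rw [← MonoidHom.comap_ker, QuotientGroup.ker_mk']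

theorem aux_identity {F G : Type*} [Group F] [Group G] (π : F →* G) (hπ : Function.Surjective π)
    (K : Subgroup G) [K.Normal] (hK : K ≤ Subgroup.center G ⊓ commutator G) :
    hopfCard π * Nat.card K = hopfCard ((QuotientGroup.mk' K).comp π) *
      (⁅π.ker, (⊤ : Subgroup F)⁆).relIndex ⁅K.comap π, (⊤ : Subgroup F)⁆ := by
  rw [hopfCard_eq, hopfCard_eq, aux_ker_mk_comp]
  have hRS : π.ker ≤ K.comap π := fun r hr => by
    rw [Subgroup.mem_comap, MonoidHom.mem_ker.mp hr]; exact K.one_mem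
  have hNT : ⁅π.ker, (⊤ : Subgroup F)⁆ ≤ ⁅K.comap π, (⊤ : Subgroup F)⁆ :=
    Subgroup.commutator_mono hRS le_rfl
  have hTR : ⁅K.comap π, (⊤ : Subgroup F)⁆ ≤ π.ker ⊓ commutator F := by
    refine le_inf ?_ (Subgroup.commutator_mono le_top le_rfl)
    rw [Subgroup.commutator_le]
    intro s hs f _
    rw [MonoidHom.mem_ker, map_commutatorElement, commutatorElement_eq_one_iff_mul_comm]
    exact (Subgroup.mem_center_iff.mp (hK hs).1 _).symm
  have hRS' : π.ker ⊓ commutator F ≤ K.comap π ⊓ commutator F := inf_le_inf_right _ hRS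
  have hcardK : (π.ker ⊓ commutator F).relIndex (K.comap π ⊓ commutator F) = Nat.card K := by
    have : π.ker ⊓ commutator F = π.ker ⊓ (K.comap π ⊓ commutator F) := by
      rw [← inf_assoc, inf_eq_left.mpr hRS]
    rw [this, Subgroup.inf_relIndex_right, Subgroup.relIndex_ker]
    have hmap : (K.comap π ⊓ commutator F).map π = K := by
      apply le_antisymm
      · rintro _ ⟨s, hs, rfl⟩
        exact hs.1
      · intro k hk
        have h1 : k ∈ (commutator F).map π := by
          rw [commutator_def, Subgroup.map_commutator, Subgroup.map_top_of_surjective _ hπ]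
          exact (hK hk).2
        obtain ⟨s, hs, rfl⟩ := h1
        exact ⟨s, ⟨hk, hs⟩, rfl⟩
    rw [hmap]
  rw [← Subgroup.relIndex_mul_relIndex _ _ _ hNT hTR,
    ← Subgroup.relIndex_mul_relIndex _ _ _ hTR hRS', hcardK]
  ring

/-- the central extension `F/[R,F] → G` -/
def auxRho {F G : Type*} [Group F] [Group G] (π : F →* G) :
    F ⧸ ⁅π.ker, (⊤ : Subgroup F)⁆ →* G :=
  QuotientGroup.lift _ π (Subgroup.commutator_le_left _ _)

theorem auxRho_mk {F G : Type*} [Group F] [Group G] (π : F →* G) (f : F) :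
    auxRho π (QuotientGroup.mk' _ f) = π f := rfl

theorem auxRho_surj {F G : Type*} [Group F] [Group G] (π : F →* G) (hπ : Function.Surjective π) :
    Function.Surjective (auxRho π) := fun g => by
  obtain ⟨f, rfl⟩ := hπ g
  exact ⟨_, auxRho_mk π f⟩

theorem auxRho_ker {F G : Type*} [Group F] [Group G] (π : F →* G) :
    (auxRho π).ker ≤ Subgroup.center _ := by
  intro g hg
  obtain ⟨f, rfl⟩ := QuotientGroup.mk'_surjective _ g
  exact aux_ker_central π f hg

theorem aux_relIndex {F G : Type*} [Group F] [Group G] (π : F →* G) (K : Subgroup G) :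
    (⁅π.ker, (⊤ : Subgroup F)⁆).relIndex ⁅K.comap π, (⊤ : Subgroup F)⁆ =
      Nat.card (⁅K.comap (auxRho π), (⊤ : Subgroup (F ⧸ ⁅π.ker, (⊤ : Subgroup F)⁆))⁆ :
        Subgroup (F ⧸ ⁅π.ker, (⊤ : Subgroup F)⁆)) := by
  have h2 := Subgroup.relIndex_ker (K := ⁅K.comap π, (⊤ : Subgroup F)⁆)
    (QuotientGroup.mk' ⁅π.ker, (⊤ : Subgroup F)⁆)
  rw [QuotientGroup.ker_mk'] at h2
  have h3 : (K.comap π).map (QuotientGroup.mk' ⁅π.ker, (⊤ : Subgroup F)⁆) =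
      K.comap (auxRho π) := by
    ext g
    obtain ⟨f, rfl⟩ := QuotientGroup.mk'_surjective _ g
    constructor
    · rintro ⟨f', hf', he⟩
      rw [← he]; exact hf'
    · intro h
      exact ⟨f, h, rfl⟩
  rw [h2, Subgroup.map_commutator,
    Subgroup.map_top_of_surjective _ (QuotientGroup.mk'_surjective _), h3]

theorem aux_hopf_abelian {F A : Type*} [Group F] [Group A] (π : F →* A)
    (hcomm : ∀ a b : A, a * b = b * a) :
    hopfCard π = Nat.card (commutator (F ⧸ ⁅π.ker, (⊤ : Subgroup F)⁆)) := by
  have h1 : commutator F ≤ π.ker := by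
    rw [commutator_def, Subgroup.commutator_le]
    intro u _ v _
    rw [MonoidHom.mem_ker, map_commutatorElement, commutatorElement_eq_one_iff_mul_comm]
    exact hcomm _ _
  rw [hopfCard_eq, inf_eq_right.mpr h1]
  have h2 := Subgroup.relIndex_ker (K := commutator F) (QuotientGroup.mk' ⁅π.ker, (⊤ : Subgroup F)⁆)
  rw [QuotientGroup.ker_mk'] at h2
  rw [h2, commutator_def, Subgroup.map_commutator,
    Subgroup.map_top_of_surjective _ (QuotientGroup.mk'_surjective _), ← commutator_def]

theorem aux_schur_quot (G : Type*) [Group G] (K : Subgroup G) [K.Normal] :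
    schurCard (G ⧸ K) = hopfCard ((QuotientGroup.mk' K).comp (FreeGroup.lift (id : G → G))) :=
  aux_hopf_indep _ _ (aux_lift_surj _)
    ((QuotientGroup.mk'_surjective K).comp (aux_lift_surj G))

theorem aux_step {p d : ℕ} (hp : p.Prime) (G : Type*) [Group G] (K : Subgroup G) [K.Normal]
    (hKp : Nat.card K = p) (hK : K ≤ Subgroup.center G ⊓ commutator G)
    (x : Fin d → G) (hx : Subgroup.closure (Set.range x) = ⊤) :
    schurCard G * p ≤ schurCard (G ⧸ K) * p ^ d := by
  have h := aux_identity (FreeGroup.lift (id : G → G)) (aux_lift_surj G) K hK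
  rw [hKp, ← aux_schur_quot, aux_relIndex] at h
  unfold schurCard at h ⊢
  rw [h]
  exact Nat.mul_le_mul_left _ (aux_stepB hp _ (auxRho_surj _ (aux_lift_surj G)) (auxRho_ker _) K
    (hK.trans inf_le_left) hKp x hx)

theorem aux_step' {p : ℕ} (hp : p.Prime) (G : Type*) [Group G] (K : Subgroup G) [K.Normal]
    (hKp : Nat.card K = p) (hK : K ≤ Subgroup.center G ⊓ commutator G) (hKG : K = commutator G) :
    schurCard G * p ≤ schurCard (G ⧸ K) * p ^ 2 := by
  have h := aux_identity (FreeGroup.lift (id : G → G)) (aux_lift_surj G) K hK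
  rw [hKp, ← aux_schur_quot, aux_relIndex] at h
  unfold schurCard at h ⊢
  rw [h]
  exact Nat.mul_le_mul_left _ (aux_stepB' hp _ (auxRho_surj _ (aux_lift_surj G)) (auxRho_ker _) K
    (hK.trans inf_le_left) hKp hKG)

theorem aux_abelian {p d m : ℕ} (hp : p.Prime) (A : Type*) [Group A] [Finite A]
    (hcomm : ∀ a b : A, a * b = b * a) (hA : Nat.card A = p ^ m)
    (x : Fin d → A) (hx : Subgroup.closure (Set.range x) = ⊤) :
    schurCard A ^ 2 ≤ p ^ ((d - 1) * m) := by
  unfold schurCard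
  rw [aux_hopf_abelian _ hcomm]
  exact aux_stepC hp hcomm hA _ (auxRho_surj _ (aux_lift_surj A)) (auxRho_ker _) x hx

theorem aux_exists_central {p n : ℕ} (hp : p.Prime) (G : Type*) [Group G] [Finite G]
    (hG : Nat.card G = p ^ n) (N : Subgroup G) [N.Normal] (hN : N ≠ ⊥) :
    ∃ K : Subgroup G, Nat.card K = p ∧ K ≤ Subgroup.center G ⊓ N := by
  have : Fact p.Prime := ⟨hp⟩
  have hdvd : p ∣ Nat.card N := by
    obtain ⟨j, _, hj⟩ := (Nat.dvd_prime_pow hp).mp (hG ▸ Subgroup.card_subgroup_dvd_card N)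
    rcases j with _ | j
    · rw [pow_zero, Subgroup.card_eq_one] at hj; exact absurd hj hN
    · rw [hj]; exact dvd_pow_self p (by omega)
  have hPG : IsPGroup p (ConjAct G) := IsPGroup.of_card (n := n) hG
  have hone : (1 : N) ∈ MulAction.fixedPoints (ConjAct G) N := by
    intro g; exact smul_one g
  obtain ⟨b, hb, hb1⟩ := hPG.exists_fixed_point_of_prime_dvd_card_of_fixed_point N hdvd hone
  have hbc : (b : G) ∈ Subgroup.center G := by
    rw [Subgroup.mem_center_iff]
    intro g
    have h1 := congrArg Subtype.val (hb (ConjAct.toConjAct g))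
    rw [ConjAct.Subgroup.val_conj_smul, ConjAct.toConjAct_smul] at h1
    exact mul_inv_eq_iff_eq_mul.mp h1
  have hne : Subgroup.center G ⊓ N ≠ ⊥ := by
    intro h
    have : (b : G) ∈ Subgroup.center G ⊓ N := ⟨hbc, b.2⟩
    rw [h, Subgroup.mem_bot] at this
    exact hb1 (Subtype.ext this.symm)
  have hdvd2 : p ∣ Nat.card (Subgroup.center G ⊓ N : Subgroup G) := by
    obtain ⟨j, _, hj⟩ := (Nat.dvd_prime_pow hp).mp
      (hG ▸ Subgroup.card_subgroup_dvd_card (Subgroup.center G ⊓ N))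
    rcases j with _ | j
    · rw [pow_zero, Subgroup.card_eq_one] at hj; exact absurd hj hne
    · rw [hj]; exact dvd_pow_self p (by omega)
  obtain ⟨c, hc⟩ := exists_prime_orderOf_dvd_card' p hdvd2
  refine ⟨Subgroup.zpowers (c : G), ?_, ?_⟩
  · rw [Nat.card_zpowers, Subgroup.orderOf_coe, hc]
  · rw [Subgroup.zpowers_le]; exact c.2

theorem aux_gen_quot {G : Type*} [Group G] (K : Subgroup G) [K.Normal] {d : ℕ}
    (x : Fin d → G) (hx : Subgroup.closure (Set.range x) = ⊤) :
    Subgroup.closure (Set.range (fun i => QuotientGroup.mk' K (x i))) = ⊤ := by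
  have : Set.range (fun i => QuotientGroup.mk' K (x i)) = QuotientGroup.mk' K '' Set.range x := by
    rw [← Set.range_comp]; rfl
  rw [this, ← MonoidHom.map_closure, hx,
    Subgroup.map_top_of_surjective _ (QuotientGroup.mk'_surjective K)]

theorem aux_card_quot {p n : ℕ} (hp : p.Prime) (G : Type*) [Group G]
    (hG : Nat.card G = p ^ (n + 1)) (K : Subgroup G) (hKp : Nat.card K = p) :
    Nat.card (G ⧸ K) = p ^ n := by
  have h := Subgroup.card_eq_card_quotient_mul_card_subgroup K
  rw [hG, hKp, pow_succ] at h
  exact (Nat.eq_of_mul_eq_mul_right hp.pos h).symm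

theorem aux_card_comm_quot {p k : ℕ} (hp : p.Prime) (G : Type*) [Group G]
    (hk : Nat.card (commutator G) = p ^ (k + 1)) (K : Subgroup G) [K.Normal]
    (hKp : Nat.card K = p) (hK : K ≤ commutator G) :
    Nat.card (commutator (G ⧸ K)) = p ^ k := by
  have h1 : Nat.card (commutator (G ⧸ K)) = K.relIndex (commutator G) := by
    have h2 := Subgroup.relIndex_ker (K := commutator G) (QuotientGroup.mk' K)
    rw [QuotientGroup.ker_mk'] at h2
    rw [h2, commutator_def G, Subgroup.map_commutator,
      Subgroup.map_top_of_surjective _ (QuotientGroup.mk'_surjective _), ← commutator_def]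
  have h3 := Subgroup.relIndex_mul_relIndex ⊥ K (commutator G) bot_le hK
  rw [Subgroup.relIndex_bot_left, Subgroup.relIndex_bot_left] at h3
  rw [h1]
  rw [hk, hKp, pow_succ, mul_comm] at h3
  exact Nat.eq_of_mul_eq_mul_right hp.pos h3

theorem aux_arith {p a b c d e : ℕ} (hp : p.Prime) (h1 : a * p ≤ b * p ^ d) (h2 : b ^ 2 ≤ p ^ c)
    (he : c + 2 * d = e + 2) : a ^ 2 ≤ p ^ e := by
  have h3 : (a * p) ^ 2 ≤ (b * p ^ d) ^ 2 := Nat.pow_le_pow_left h1 2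
  have h4 : a ^ 2 * p ^ 2 ≤ p ^ e * p ^ 2 := by
    calc a ^ 2 * p ^ 2 = (a * p) ^ 2 := by ring
      _ ≤ (b * p ^ d) ^ 2 := h3
      _ = b ^ 2 * p ^ (2 * d) := by ring
      _ ≤ p ^ c * p ^ (2 * d) := Nat.mul_le_mul_right _ h2
      _ = p ^ e * p ^ 2 := by rw [← pow_add, ← pow_add, he]
  exact Nat.le_of_mul_le_mul_right h4 (pow_pos hp.pos 2)

theorem aux_d_pos {G : Type*} [Group G] {d : ℕ} (x : Fin d → G)
    (hx : Subgroup.closure (Set.range x) = ⊤) (h1 : Nat.card G ≠ 1) : 0 < d := by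
  rcases Nat.eq_zero_or_pos d with h | h
  · subst h
    rw [Set.range_eq_empty, Subgroup.closure_empty] at hx
    exact absurd (by rw [← Subgroup.card_top, ← hx, Subgroup.card_bot]) h1
  · exact h

theorem aux_le_exp {p n k : ℕ} (hp : p.Prime) (G : Type*) [Group G] [Finite G]
    (hG : Nat.card G = p ^ n) (hk : Nat.card (commutator G) = p ^ k) : k ≤ n := by
  have h := Subgroup.card_le_card_group (commutator G)
  rw [hG, hk] at h
  exact (Nat.pow_le_pow_iff_right hp.one_lt).mp h

theorem aux_upper {p d : ℕ} (hp : p.Prime) (k : ℕ) : ∀ (n : ℕ) (G : Type*) [Group G] [Finite G]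
    (_ : Nat.card G = p ^ n) (_ : Nat.card (commutator G) = p ^ (k + 1))
    (x : Fin d → G) (_ : Subgroup.closure (Set.range x) = ⊤),
    schurCard G ^ 2 ≤ p ^ ((d - 1) * (n + k - 1) + 2) := by
  induction k with
  | zero =>
    intro n G _ _ hG hk x hx
    have hne : commutator G ≠ ⊥ := by
      intro h
      rw [h, Subgroup.card_bot, zero_add, pow_one] at hk
      exact hp.one_lt.ne hk
    have hn := aux_le_exp hp G hG hk
    obtain ⟨n, rfl⟩ : ∃ m, n = m + 1 := ⟨n - 1, by omega⟩
    obtain ⟨K, hKp, hKle⟩ := aux_exists_central hp G hG (commutator G) hne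
    have hKG : K = commutator G :=
      Subgroup.eq_of_le_of_card_ge (hKle.trans inf_le_right) (by rw [hk, hKp]; simp)
    have hKn : K.Normal := normal_of_le_center' (hKle.trans inf_le_left)
    have h1 := aux_step' hp G K hKp hKle hKG
    have h2 := aux_abelian hp (G ⧸ K) (by
      intro a b
      obtain ⟨a, rfl⟩ := QuotientGroup.mk'_surjective K a
      obtain ⟨b, rfl⟩ := QuotientGroup.mk'_surjective K b
      rw [← commutatorElement_eq_one_iff_mul_comm, ← map_commutatorElement, ← MonoidHom.mem_ker,
        QuotientGroup.ker_mk', hKG]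
      exact Subgroup.commutator_mem_commutator (Subgroup.mem_top _) (Subgroup.mem_top _))
      (aux_card_quot hp G hG K hKp) _ (aux_gen_quot K x hx)
    exact aux_arith hp h1 h2 (by simp)
  | succ k ih =>
    intro n G _ _ hG hk x hx
    have hne : commutator G ≠ ⊥ := by
      intro h
      rw [h, Subgroup.card_bot] at hk
      exact (Nat.one_lt_pow (by omega) hp.one_lt).ne hk
    have hn := aux_le_exp hp G hG hk
    obtain ⟨n, rfl⟩ : ∃ m, n = m + 1 := ⟨n - 1, by omega⟩
    obtain ⟨K, hKp, hKle⟩ := aux_exists_central hp G hG (commutator G) hne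
    have hKn : K.Normal := normal_of_le_center' (hKle.trans inf_le_left)
    have h1 := aux_step hp G K hKp hKle x hx
    have h2 := ih n (G ⧸ K) (aux_card_quot hp G hG K hKp)
      (aux_card_comm_quot hp G hk K hKp (hKle.trans inf_le_right)) _ (aux_gen_quot K x hx)
    refine aux_arith hp h1 h2 ?_
    have hd := aux_d_pos x hx (by rw [hG]; exact (Nat.one_lt_pow (by omega) hp.one_lt).ne')
    obtain ⟨d, rfl⟩ : ∃ m, d = m + 1 := ⟨d - 1, by omega⟩
    have e1 : n + 1 + (k + 1) - 1 = (n + k - 1) + 2 := by omega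
    rw [e1, Nat.add_sub_cancel]
    ring

/-- If a non-abelian finite `p`-group `G` of order `p ^ n`, with `|G'| = p ^ k`, `k ≥ 2`,
`d = d(G)`, attains the bound `|M(G)| = p ^ ((1/2)*(d-1)*(n+k-2)+1)` (stated squared),
and `K ≤ Z(G) ∩ G'` has order `p`, then `|M(G/K)| = p ^ ((1/2)*(d-1)*(n+k-4)+1)`
(stated squared), i.e. `|M(G/K)|` attains the bound for `G/K`. -/
theorem schur_bound_quotient_central_of_order_p
    {p n k d : ℕ} (hp : p.Prime) (G : Type*) [Group G] [Finite G]
    (hG : Nat.card G = p ^ n) (hna : ∃ a b : G, a * b ≠ b * a)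
    (hk : Nat.card (commutator G) = p ^ k) (hk2 : 2 ≤ k)
    (hd : d = minGens G)
    (hM : schurCard G ^ 2 = p ^ ((d - 1) * (n + k - 2) + 2))
    (K : Subgroup G) (hKord : Nat.card K = p)
    (hKle : K ≤ Subgroup.center G ⊓ commutator G) :
    haveI : K.Normal := normal_of_le_center' (hKle.trans inf_le_left)
    schurCard (G ⧸ K) ^ 2 = p ^ ((d - 1) * (n + k - 4) + 2) := by
  have hKn : K.Normal := normal_of_le_center' (hKle.trans inf_le_left)
  obtain ⟨x, hx⟩ : ∃ x : Fin d → G, Subgroup.closure (Set.range x) = ⊤ := by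
    have hmem : minGens G ∈
        {n | ∃ S : Finset G, S.card = n ∧ Subgroup.closure (S : Set G) = ⊤} := by
      apply Nat.sInf_mem
      have := Fintype.ofFinite G
      exact ⟨_, Finset.univ, rfl, by simp⟩
    obtain ⟨S, hS, hcl⟩ := hmem
    rw [← hd] at hS
    refine ⟨fun i => ((S.equivFinOfCardEq hS).symm i : G), ?_⟩
    rw [← hcl]
    congr 1
    ext g
    constructor
    · rintro ⟨i, rfl⟩
      exact ((S.equivFinOfCardEq hS).symm i).2
    · intro hg
      exact ⟨S.equivFinOfCardEq hS ⟨g, hg⟩, by simp⟩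
  have hn := aux_le_exp hp G hG hk
  obtain ⟨n, rfl⟩ : ∃ m, n = m + 1 := ⟨n - 1, by omega⟩
  obtain ⟨k, rfl⟩ : ∃ m, k = m + 2 := ⟨k - 2, by omega⟩
  have hdp := aux_d_pos x hx (by rw [hG]; exact (Nat.one_lt_pow (by omega) hp.one_lt).ne')
  have e1 : n + 1 + (k + 2) - 2 = (n + k - 1) + 2 := by omega
  have e2 : n + 1 + (k + 2) - 4 = n + k - 1 := by omega
  have h1 := aux_step hp G K hKord hKle x hx
  have h2 := aux_upper hp k n (G ⧸ K) (aux_card_quot hp G hG K hKord)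
    (aux_card_comm_quot hp G hk K hKord (hKle.trans inf_le_right)) _ (aux_gen_quot K x hx)
  rw [e1] at hM
  rw [e2]
  refine le_antisymm h2 ?_
  have h3 : (schurCard G * p) ^ 2 ≤ (schurCard (G ⧸ K) * p ^ d) ^ 2 := Nat.pow_le_pow_left h1 2
  rw [mul_pow, mul_pow, hM, ← pow_mul, ← pow_add] at h3
  obtain ⟨d', rfl⟩ : ∃ m, d = m + 1 := ⟨d - 1, by omega⟩
  rw [Nat.add_sub_cancel] at h3 ⊢
  have e3 : d' * (n + k - 1 + 2) + 2 + 2 = (d' * (n + k - 1) + 2) + (d' + 1) * 2 := by ring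
  rw [e3, pow_add] at h3
  exact Nat.le_of_mul_le_mul_right h3 (pow_pos hp.pos _)
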